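/- For every nonnegative integer n, the number of square-lattice walks of length 2n that start at (−1,0), end at (−1,0), and are confined to the three-quadrant cone C equals (16^n / 3) · ( 2 · (1/2)_n (7/6)_n / ( (2)_n (4/3)_n ) + (1/2)_n (5/6)_n / ( (2)_n (5/3)_n ) ). -/

import Mathlib

/-- Square-lattice steps. -/
def squareSteps : Set (ℤ × ℤ) := {(1,0), (-1,0), (0,1), (0,-1)}

/-- Diagonal-lattice steps. -/
def diagSteps : Set (ℤ × ℤ) := {(1,1), (1,-1), (-1,1), (-1,-1)}

/-- The three-quadrant cone `C = {(i,j) : i ≥ 0 or j ≥ 0}`. -/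
def coneC : Set (ℤ × ℤ) := {p | 0 ≤ p.1 ∨ 0 ≤ p.2}

/-- The quadrant `Q = {(i,j) : i ≥ 0 and j ≥ 0}`. -/
def quadQ : Set (ℤ × ℤ) := {p | 0 ≤ p.1 ∧ 0 ≤ p.2}

/-- Number of walks of length `n` with steps in `steps`, from `a` to `b`,
confined to `region`. -/
noncomputable def walkCount (steps region : Set (ℤ × ℤ)) (a b : ℤ × ℤ) (n : ℕ) : ℕ :=
  Nat.card {w : Fin (n+1) → ℤ × ℤ //
    w 0 = a ∧ w (Fin.last n) = b ∧
    (∀ k : Fin n, w k.succ - w k.castSucc ∈ steps) ∧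
    (∀ k, w k ∈ region)}

/-- Ascending factorial (Pochhammer symbol) `(a)ₙ = a(a+1)⋯(a+n-1)`. -/
noncomputable def poch (a : ℚ) (n : ℕ) : ℚ := (ascPochhammer ℚ n).eval a

section LoopCount

open PowerSeries

section HypergeometricSystem

variable {S R : Type*} [CommRing S] [CommRing R] [Algebra S R] (δ : Derivation S R R) {x y q : R}

lemma derivation_fst (hq : δ q = 2 * q) (h₁ : (x - y) * (x + y) ^ 3 = 3 * q)
    (h₂ : x ^ 2 + 2 * x * y - 2 * y ^ 2 = 1 + q) [IsDomain R] [CharZero R] (hxy : x + y ≠ 0) :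
    (x - 2 * y) * δ x = 1 + y ^ 2 - 2 * x * y := by
  have d₁ := congrArg δ h₁
  have d₂ := congrArg δ h₂
  simp only [map_add, map_sub, Derivation.leibniz, Derivation.leibniz_pow, smul_eq_mul, hq,
    nsmul_eq_mul, Derivation.map_one_eq_zero,
    show δ (2 : R) = 0 from δ.map_natCast 2, show δ (3 : R) = 0 from δ.map_natCast 3] at d₁ d₂
  norm_num at d₁ d₂
  refine mul_left_cancel₀ (mul_ne_zero (two_ne_zero (α := R)) (pow_ne_zero 2 hxy)) ?_
  linear_combination d₁ - (x + y) ^ 2 * d₂ - 2 * h₁ + 2 * (x + y) ^ 2 * h₂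

lemma derivation_snd (hq : δ q = 2 * q) (h₁ : (x - y) * (x + y) ^ 3 = 3 * q)
    (h₂ : x ^ 2 + 2 * x * y - 2 * y ^ 2 = 1 + q) [IsDomain R] [CharZero R] (hxy : x + y ≠ 0) :
    (x - 2 * y) ^ 2 * δ y = x ^ 3 + 2 * x ^ 2 * y - 5 * x * y ^ 2 + 3 * y ^ 3 - 2 * x + y := by
  have d₂ := congrArg δ h₂
  simp only [map_add, map_sub, Derivation.leibniz, Derivation.leibniz_pow, smul_eq_mul, hq,
    nsmul_eq_mul, Derivation.map_one_eq_zero, show δ (2 : R) = 0 from δ.map_natCast 2] at d₂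
  norm_num at d₂
  refine mul_left_cancel₀ (two_ne_zero (α := R)) ?_
  linear_combination (x - 2 * y) * d₂ - 2 * (x + y) * derivation_fst δ hq h₁ h₂ hxy
    - 2 * (x - 2 * y) * h₂

lemma hypergeometric_fst (hq : δ q = 2 * q) (h₁ : (x - y) * (x + y) ^ 3 = 3 * q)
    (h₂ : x ^ 2 + 2 * x * y - 2 * y ^ 2 = 1 + q) [IsDomain R] [CharZero R] (hxy : x + y ≠ 0)
    (hd : x - 2 * y ≠ 0) :
    3 * δ (δ x) - 2 * δ x = q * (3 * δ (δ x) - 4 * δ x + x) := by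
  have hx := derivation_fst δ hq h₁ h₂ hxy
  have hy := derivation_snd δ hq h₁ h₂ hxy
  have hxx := congrArg δ hx
  simp only [map_add, map_sub, Derivation.leibniz, Derivation.leibniz_pow, smul_eq_mul,
    nsmul_eq_mul, Derivation.map_one_eq_zero, show δ (2 : R) = 0 from δ.map_natCast 2] at hxx
  norm_num at hxx
  obtain rfl : q = x ^ 2 + 2 * x * y - 2 * y ^ 2 - 1 := by linear_combination -h₂
  generalize δ (δ x) = x₂ at *
  generalize δ x = x₁ at *
  generalize δ y = y₁ at *
  set D := x - 2 * y with hD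
  set N := 1 + y ^ 2 - 2 * x * y with hN
  set M := x ^ 3 + 2 * x ^ 2 * y - 5 * x * y ^ 2 + 3 * y ^ 3 - 2 * x + y with hM
  have e₀ : D * x₂ = 2 * y * y₁ - 2 * x₁ * y - 2 * x * y₁ - (x₁ - 2 * y₁) * x₁ := by
    linear_combination hxx
  have e₁ : D ^ 4 * x₂ = D * (2 * y * M - 2 * x * M) - 2 * y * N * D ^ 2 - N * N * D
      + 2 * M * N := by
    linear_combination D ^ 3 * e₀ + (2 * y * D - 2 * x * D) * hy - 2 * y * D ^ 2 * hx
      - D * (D * x₁ + N) * hx + 2 * D ^ 2 * y₁ * hx + 2 * N * hy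
  refine mul_left_cancel₀ (pow_ne_zero 4 hd) ?_
  linear_combination (3 - 3 * (x ^ 2 + 2 * x * y - 2 * y ^ 2 - 1)) * e₁
    + (- 2 + 4 * (x ^ 2 + 2 * x * y - 2 * y ^ 2 - 1)) * D ^ 3 * hx
    + (5 * x ^ 3 + 6 * x ^ 2 * y - 18 * x * y ^ 2 - 10 * x + 8 * y ^ 3 + 8 * y) * h₁

lemma hypergeometric_snd (hq : δ q = 2 * q) (h₁ : (x - y) * (x + y) ^ 3 = 3 * q)
    (h₂ : x ^ 2 + 2 * x * y - 2 * y ^ 2 = 1 + q) [IsDomain R] [CharZero R] (hxy : x + y ≠ 0)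
    (hd : x - 2 * y ≠ 0) :
    3 * δ (δ y) - 4 * δ y = q * (3 * δ (δ y) - 2 * δ y - y) := by
  have hx := derivation_fst δ hq h₁ h₂ hxy
  have hy := derivation_snd δ hq h₁ h₂ hxy
  have hyy := congrArg δ hy
  simp only [map_add, map_sub, Derivation.leibniz, Derivation.leibniz_pow, smul_eq_mul,
    nsmul_eq_mul, show δ (2 : R) = 0 from δ.map_natCast 2,
    show δ (3 : R) = 0 from δ.map_natCast 3, show δ (5 : R) = 0 from δ.map_natCast 5] at hyy
  norm_num at hyy
  obtain rfl : q = x ^ 2 + 2 * x * y - 2 * y ^ 2 - 1 := by linear_combination -h₂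
  generalize δ (δ y) = y₂ at *
  generalize δ x = x₁ at *
  generalize δ y = y₁ at *
  set D := x - 2 * y with hD
  set N := 1 + y ^ 2 - 2 * x * y with hN
  set M := x ^ 3 + 2 * x ^ 2 * y - 5 * x * y ^ 2 + 3 * y ^ 3 - 2 * x + y with hM
  have e₀ : D ^ 2 * y₂ = (3 * x ^ 2 + 4 * x * y - 5 * y ^ 2 - 2) * x₁
      + (2 * x ^ 2 - 10 * x * y + 9 * y ^ 2 + 1) * y₁ - 2 * D * (x₁ - 2 * y₁) * y₁ := by
    linear_combination hyy
  have e₁ : D ^ 5 * y₂ = D ^ 2 * (3 * x ^ 2 + 4 * x * y - 5 * y ^ 2 - 2) * N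
      + D * (2 * x ^ 2 - 10 * x * y + 9 * y ^ 2 + 1) * M - 2 * D * N * M + 4 * M * M := by
    linear_combination D ^ 3 * e₀ + D ^ 2 * (3 * x ^ 2 + 4 * x * y - 5 * y ^ 2 - 2) * hx
      + D * (2 * x ^ 2 - 10 * x * y + 9 * y ^ 2 + 1) * hy
      - 2 * D ^ 3 * y₁ * hx - 2 * D * N * hy + 4 * (D ^ 2 * y₁ + M) * hy
  refine mul_left_cancel₀ (pow_ne_zero 5 hd) ?_
  linear_combination (3 - 3 * (x ^ 2 + 2 * x * y - 2 * y ^ 2 - 1)) * e₁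
    + (- 4 + 2 * (x ^ 2 + 2 * x * y - 2 * y ^ 2 - 1)) * D ^ 3 * hy
    + (- 16 * x ^ 4 - 19 * x ^ 3 * y + 60 * x ^ 2 * y ^ 2 + 32 * x ^ 2 - 22 * x * y ^ 3
      - 26 * x * y - 4 * y ^ 4 - 4 * y ^ 2) * h₁

end HypergeometricSystem

instance powerSeriesRat_charZero : CharZero ℚ⟦X⟧ := algebraRat.charZero _

/-- The derivation `f ↦ X f'`, multiplying the `n`-th coefficient by `n`. -/
noncomputable def eulerDerivation : Derivation ℚ ℚ⟦X⟧ ℚ⟦X⟧ :=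
  (X : ℚ⟦X⟧) • d⁄dX ℚ

lemma coeff_eulerDerivation (f : ℚ⟦X⟧) (n : ℕ) :
    coeff n (eulerDerivation f) = n * coeff n f := by
  change coeff n (X * d⁄dX ℚ f) = _
  cases n with
  | zero => simp
  | succ n => rw [coeff_succ_X_mul, coeff_derivative]; push_cast; ring

lemma eulerDerivation_sixteen_mul_X_sq :
    eulerDerivation (16 * X ^ 2) = 2 * (16 * X ^ 2) := by
  change X * d⁄dX ℚ (16 * X ^ 2) = _
  rw [Derivation.leibniz, Derivation.leibniz_pow, derivative_X,
    show d⁄dX ℚ (16 : ℚ⟦X⟧) = 0 from Derivation.map_natCast _ 16]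
  simp only [smul_eq_mul, nsmul_eq_mul]
  push_cast
  ring

lemma coeff_sixteen_mul_X_sq_mul (f : ℚ⟦X⟧) (n : ℕ) :
    coeff (n + 2) (16 * X ^ 2 * f) = 16 * coeff n f := by
  rw [show (16 : ℚ⟦X⟧) * X ^ 2 * f = (16 : ℕ) • (X ^ 2 * f) by simp; ring, map_nsmul,
    coeff_X_pow_mul]
  simp

lemma poch_succ (a : ℚ) (n : ℕ) : poch a (n + 1) = poch a n * (a + n) := by
  simp [poch, ascPochhammer_succ_eval]

lemma poch_ne_zero {a : ℚ} (ha : 0 < a) (n : ℕ) : poch a n ≠ 0 :=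
  (ascPochhammer_pos n a ha).ne'

lemma coeff_fst_of_system {x y : ℚ⟦X⟧} (hx : constantCoeff x = 1) (hy : constantCoeff y = 1)
    (h₁ : (x - y) * (x + y) ^ 3 = 3 * (16 * X ^ 2))
    (h₂ : x ^ 2 + 2 * x * y - 2 * y ^ 2 = 1 + 16 * X ^ 2) (n : ℕ) :
    coeff (2 * n + 2) x = 2 * 16 ^ n * (poch (1/2) n * poch (5/6) n) /
      (poch 2 n * poch (5/3) n) := by
  have hxy : x + y ≠ 0 := fun h => by
    have := congrArg constantCoeff h
    rw [map_add, hx, hy] at this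
    norm_num at this
  have hd : x - 2 * y ≠ 0 := fun h => by
    have := congrArg constantCoeff h
    rw [map_sub, map_mul, hx, hy, map_ofNat] at this
    norm_num at this
  have key := hypergeometric_fst eulerDerivation eulerDerivation_sixteen_mul_X_sq h₁ h₂ hxy hd
  have hrec (m : ℕ) : (3 * (m + 2 : ℚ) ^ 2 - 2 * (m + 2)) * coeff (m + 2) x
      = 16 * (3 * (m : ℚ) ^ 2 - 4 * m + 1) * coeff m x := by
    have := congrArg (coeff (m + 2)) key
    rw [coeff_sixteen_mul_X_sq_mul] at this
    simp only [← nsmul_eq_mul, ← Nat.cast_ofNat (R := ℚ⟦X⟧), map_add, map_sub, map_nsmul,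
      coeff_eulerDerivation] at this
    simp only [nsmul_eq_mul] at this
    push_cast at this
    linear_combination this
  induction n with
  | zero =>
    have := hrec 0
    rw [coeff_zero_eq_constantCoeff_apply, hx] at this
    norm_num at this
    simp [poch]
    linarith
  | succ n ih =>
    have := hrec (2 * n + 2)
    rw [ih] at this
    have e : 2 * (n + 1) + 2 = 2 * n + 2 + 2 := by ring
    rw [e]
    have h0 : (3 * (((2 * n + 2 : ℕ) : ℚ) + 2) ^ 2 - 2 * (((2 * n + 2 : ℕ) : ℚ) + 2)) ≠ 0 := by
      push_cast
      have : (0 : ℚ) ≤ n := n.cast_nonneg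
      nlinarith
    refine mul_left_cancel₀ h0 (this.trans ?_)
    simp only [poch_succ]
    have p1 := poch_ne_zero (a := 2) (by norm_num) n
    have p2 := poch_ne_zero (a := 5/3) (by norm_num) n
    have q1 : (2 + n : ℚ) ≠ 0 := by positivity
    have q2 : (5/3 + n : ℚ) ≠ 0 := by positivity
    push_cast
    field_simp
    ring

lemma coeff_snd_of_system {x y : ℚ⟦X⟧} (hx : constantCoeff x = 1) (hy : constantCoeff y = 1)
    (h₁ : (x - y) * (x + y) ^ 3 = 3 * (16 * X ^ 2))
    (h₂ : x ^ 2 + 2 * x * y - 2 * y ^ 2 = 1 + 16 * X ^ 2) (n : ℕ) :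
    coeff (2 * n + 2) y = -4 * 16 ^ n * (poch (1/2) n * poch (7/6) n) /
      (poch 2 n * poch (4/3) n) := by
  have hxy : x + y ≠ 0 := fun h => by
    have := congrArg constantCoeff h
    rw [map_add, hx, hy] at this
    norm_num at this
  have hd : x - 2 * y ≠ 0 := fun h => by
    have := congrArg constantCoeff h
    rw [map_sub, map_mul, hx, hy, map_ofNat] at this
    norm_num at this
  have key := hypergeometric_snd eulerDerivation eulerDerivation_sixteen_mul_X_sq h₁ h₂ hxy hd
  have hrec (m : ℕ) : (3 * (m + 2 : ℚ) ^ 2 - 4 * (m + 2)) * coeff (m + 2) y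
      = 16 * (3 * (m : ℚ) ^ 2 - 2 * m - 1) * coeff m y := by
    have := congrArg (coeff (m + 2)) key
    rw [coeff_sixteen_mul_X_sq_mul] at this
    simp only [← nsmul_eq_mul, ← Nat.cast_ofNat (R := ℚ⟦X⟧), map_sub, map_nsmul,
      coeff_eulerDerivation] at this
    simp only [nsmul_eq_mul] at this
    push_cast at this
    linear_combination this
  induction n with
  | zero =>
    have := hrec 0
    rw [coeff_zero_eq_constantCoeff_apply, hy] at this
    norm_num at this
    simp [poch]
    linarith
  | succ n ih =>
    have := hrec (2 * n + 2)
    rw [ih] at this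
    have e : 2 * (n + 1) + 2 = 2 * n + 2 + 2 := by ring
    rw [e]
    have h0 : (3 * (((2 * n + 2 : ℕ) : ℚ) + 2) ^ 2 - 4 * (((2 * n + 2 : ℕ) : ℚ) + 2)) ≠ 0 := by
      push_cast
      have : (0 : ℚ) ≤ n := n.cast_nonneg
      nlinarith
    refine mul_left_cancel₀ h0 (this.trans ?_)
    simp only [poch_succ]
    have p1 := poch_ne_zero (a := 2) (by norm_num) n
    have p2 := poch_ne_zero (a := 4/3) (by norm_num) n
    have q1 : (2 + n : ℚ) ≠ 0 := by positivity
    have q2 : (4/3 + n : ℚ) ≠ 0 := by positivity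
    push_cast
    field_simp
    ring

/-- Three double-root conditions and one simple-root condition on a one-parameter family of cubics
pin down the leading coefficient and the simple root. -/
lemma system_of_double_roots {R : Type*} [CommRing R] [IsDomain R] [CharZero R]
    {A B γ t z₁ z₂ z₃ r c₁ c₂ c₃ : R}
    (hc₁ : c₁ = 2 * t - 4 * t ^ 2) (hc₂ : c₂ = -2 * t - 4 * t ^ 2) (hc₃ : 4 * c₃ = 1)
    (f₁ : z₁ ^ 3 - A * z₁ ^ 2 - B * z₁ - γ + c₁ * z₁ = 0)
    (g₁ : 3 * z₁ ^ 2 - 2 * A * z₁ - B + c₁ = 0)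
    (f₂ : z₂ ^ 3 - A * z₂ ^ 2 - B * z₂ - γ + c₂ * z₂ = 0)
    (g₂ : 3 * z₂ ^ 2 - 2 * A * z₂ - B + c₂ = 0)
    (f₃ : z₃ ^ 3 - A * z₃ ^ 2 - B * z₃ - γ + c₃ * z₃ = 0)
    (g₃ : 3 * z₃ ^ 2 - 2 * A * z₃ - B + c₃ = 0)
    (fr : r ^ 3 - A * r ^ 2 - B * r - γ + c₃ * r = 0)
    (h₁₂ : z₁ ≠ z₂) (h₁₃ : z₁ ≠ z₃) (h₂₃ : z₂ ≠ z₃) (hr : r ≠ z₃) :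
    ∃ y, 2 * (A - y) = 3 * r ∧ y = 2 * z₃ - (z₁ + z₂) ∧
      (A - y) * (A + y) ^ 3 = 3 * (16 * t ^ 2) ∧
      A ^ 2 + 2 * A * y - 2 * y ^ 2 = 1 + 16 * t ^ 2 := by
  have e₁₂ : 2 * (z₁ ^ 2 + z₁ * z₂ + z₂ ^ 2) - A * (z₁ + z₂) = 0 :=
    mul_left_cancel₀ (sub_ne_zero.2 h₁₂)
      (by linear_combination z₁ * g₁ - f₁ - z₂ * g₂ + f₂)
  have e₁₃ : 2 * (z₁ ^ 2 + z₁ * z₃ + z₃ ^ 2) - A * (z₁ + z₃) = 0 :=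
    mul_left_cancel₀ (sub_ne_zero.2 h₁₃)
      (by linear_combination z₁ * g₁ - f₁ - z₃ * g₃ + f₃)
  have hA : A = 2 * (z₁ + z₂ + z₃) :=
    mul_left_cancel₀ (sub_ne_zero.2 h₂₃) (by linear_combination e₁₃ - e₁₂)
  have hp : z₁ * z₂ = -(z₃ * (z₁ + z₂)) :=
    mul_left_cancel₀ (two_ne_zero (α := R)) (by
      linear_combination -e₁₂ - (z₁ + z₂) * hA)
  have hr' : r = 2 * (z₁ + z₂) := by
    refine mul_left_cancel₀ (pow_ne_zero 2 (sub_ne_zero.2 hr)) ?_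
    linear_combination fr - f₃ - (r - z₃) * g₃ + (r - z₃) ^ 2 * hA
  have hd : (z₁ - z₂) * (z₁ + z₂ + 4 * z₃) = 4 * t := by
    linear_combination g₂ - g₁ + hc₁ - hc₂ - 2 * (z₁ - z₂) * hA
  refine ⟨2 * z₃ - (z₁ + z₂), ?_, rfl, ?_, ?_⟩
  · linear_combination 2 * hA - 3 * hr'
  · rw [hA]
    linear_combination 3 * ((z₁ - z₂) * (z₁ + z₂ + 4 * z₃) + 4 * t) * hd +
      12 * (z₁ + z₂ + 4 * z₃) ^ 2 * hp
  · refine mul_left_cancel₀ (two_ne_zero (α := R)) ?_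
    subst hA
    linear_combination 4 * (g₁ + g₂ - 2 * g₃) - 4 * hc₁ - 4 * hc₂ + 2 * hc₃ + 24 * hp

open PowerSeries.WithPiTopology in
lemma exists_evalHom {k : Type*} [CommRing k] (V : k⟦X⟧) (hV : constantCoeff V = 0) :
    ∃ φ : (k⟦X⟧)⟦X⟧ →+* k⟦X⟧, φ X = V ∧ (∀ r, φ (C r) = r) ∧
      ∀ F, constantCoeff (φ F) = constantCoeff (constantCoeff F) := by
  let : UniformSpace k := ⊥
  have : DiscreteUniformity k := ⟨rfl⟩
  have : IsLinearTopology k⟦X⟧ k⟦X⟧ := inferInstance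
  have hE : HasEval V := isTopologicallyNilpotent_of_constantCoeff_zero hV
  have hX : eval₂Hom (φ := RingHom.id k⟦X⟧) continuous_id hE X = V := by
    rw [coe_eval₂Hom, eval₂_X]
  have hC (r : k⟦X⟧) : eval₂Hom (φ := RingHom.id k⟦X⟧) continuous_id hE (C r) = r := by
    rw [coe_eval₂Hom, eval₂_C, RingHom.id_apply]
  refine ⟨eval₂Hom (φ := RingHom.id k⟦X⟧) continuous_id hE, hX, hC, fun F => ?_⟩
  conv_lhs => rw [eq_X_mul_shift_add_const F]
  rw [map_add, map_mul, hX, hC, map_add, map_mul, hV, zero_mul, zero_add]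

/-- The kernel `u v - t (1 + v) (1 + u² v)` of the Gessel step set, as a series in `v` over series
in `u` over series in `t`. -/
noncomputable def gesselKernel : ℚ⟦X⟧⟦X⟧⟦X⟧ :=
  C X * X - C (C X) * ((1 + X) * (1 + C X ^ 2 * X))

lemma coeff_gesselKernel_mul (Q : ℚ⟦X⟧⟦X⟧⟦X⟧) (k l : ℕ) :
    coeff (k + 1) (coeff (l + 1) (gesselKernel * Q)) =
      coeff k (coeff l Q) - X * (coeff (k + 1) (coeff (l + 1) Q) + coeff (k + 1) (coeff l Q)
        + (if 1 ≤ k then coeff (k - 1) (coeff l Q) else 0)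
        + (if 1 ≤ k ∧ 1 ≤ l then coeff (k - 1) (coeff (l - 1) Q) else 0)) := by
  have : gesselKernel * Q = X * (C X * Q) - C (C X) * (Q + X * Q + X * (C (X ^ 2) * Q)
      + X * (X * (C (X ^ 2) * Q))) := by
    rw [gesselKernel, map_pow]; ring
  rw [this]
  rcases k with _ | k <;> rcases l with _ | l <;>
    simp [coeff_succ_X_mul, coeff_C_mul, coeff_X_pow_mul', mul_add, add_assoc, -map_pow]

lemma eq_zero_of_forall_coeff_gesselKernel_mul {Q : ℚ⟦X⟧⟦X⟧⟦X⟧}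
    (h : ∀ k l, coeff (k + 1) (coeff (l + 1) (gesselKernel * Q)) = 0) : Q = 0 := by
  have key (n : ℕ) : ∀ k l, coeff n (coeff k (coeff l Q)) = 0 := by
    induction n with
    | zero =>
      intro k l
      have := h k l
      rw [coeff_gesselKernel_mul, sub_eq_zero] at this
      rw [this, coeff_zero_X_mul]
    | succ n ih =>
      intro k l
      have := h k l
      rw [coeff_gesselKernel_mul, sub_eq_zero] at this
      rw [this, coeff_succ_X_mul]
      simp only [map_add, ih, apply_ite (coeff n), map_zero, ite_self, add_zero]
  ext l k n
  exact key n k l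

lemma invariant_eq_const {I J : ℚ⟦X⟧⟦X⟧}
    (h : gesselKernel ∣ C I - PowerSeries.map C J) :
    I = C (constantCoeff J) ∧ J = C (constantCoeff J) := by
  obtain ⟨Q, hQ⟩ := h
  have hQ0 : Q = 0 := eq_zero_of_forall_coeff_gesselKernel_mul fun k l => by
    rw [← hQ]
    simp
  rw [hQ0, mul_zero, sub_eq_zero] at hQ
  have hJ (l : ℕ) : coeff l (C I) = C (coeff l J) := by rw [hQ, coeff_map]
  refine ⟨by simpa using hJ 0, ?_⟩
  ext1 l
  rcases l with _ | l
  · simp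
  · have := hJ (l + 1)
    rw [coeff_C, if_neg l.succ_ne_zero] at this
    rw [coeff_C, if_neg l.succ_ne_zero]
    have h0 := congrArg constantCoeff this
    simpa using h0.symm

lemma C_X_dvd_of_map_constantCoeff {Q : ℚ⟦X⟧⟦X⟧⟦X⟧}
    (h : PowerSeries.map constantCoeff Q = 0) : C X ∣ Q := by
  refine ⟨PowerSeries.mk fun l => PowerSeries.mk fun k => coeff (k + 1) (coeff l Q), ?_⟩
  ext1 l
  have := congrArg (coeff l) h
  rw [coeff_map, map_zero] at this
  rw [coeff_C_mul, coeff_mk]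
  conv_lhs => rw [eq_X_mul_shift_add_const (coeff l Q), this, map_zero, add_zero]

lemma gesselKernel_dvd_of_dvd_C_X_mul {F : ℚ⟦X⟧⟦X⟧⟦X⟧} (h : gesselKernel ∣ C X * F) :
    gesselKernel ∣ F := by
  obtain ⟨Q, hQ⟩ := h
  have hm := congrArg (PowerSeries.map constantCoeff) hQ
  simp only [gesselKernel, map_mul, map_sub, map_add, map_one, map_pow, map_C, map_X,
    constantCoeff_X, constantCoeff_C] at hm
  simp only [map_zero, zero_mul, zero_sub, ne_eq, OfNat.ofNat_ne_zero, not_false_eq_true,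
    zero_pow, add_zero, mul_one, zero_eq_mul, neg_eq_zero, mul_eq_zero] at hm
  have h1 : (1 + X : ℚ⟦X⟧⟦X⟧) ≠ 0 := fun h => by simpa using congrArg constantCoeff h
  have h2 : (C X : ℚ⟦X⟧⟦X⟧) ≠ 0 := fun h => by
    simpa using congrArg (coeff 1) (congrArg constantCoeff h)
  obtain ⟨Q', rfl⟩ := C_X_dvd_of_map_constantCoeff (by tauto)
  have h3 : (C X : ℚ⟦X⟧⟦X⟧⟦X⟧) ≠ 0 := fun h => by
    simpa using congrArg (coeff 1) (congrArg constantCoeff h)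
  exact ⟨Q', mul_left_cancel₀ h3 (by linear_combination hQ)⟩

lemma gesselKernel_dvd_of_dvd_X_mul {F : ℚ⟦X⟧⟦X⟧⟦X⟧} (h : gesselKernel ∣ X * F) :
    gesselKernel ∣ F := by
  obtain ⟨Q, hQ⟩ := h
  have hm := congrArg constantCoeff hQ
  simp only [gesselKernel, map_mul, map_sub, map_add, map_one, map_pow, constantCoeff_X,
    constantCoeff_C] at hm
  simp only [mul_zero, zero_mul, zero_sub, add_zero, mul_one, zero_eq_mul, neg_eq_zero] at hm
  have h2 : (C X : ℚ⟦X⟧⟦X⟧) ≠ 0 := fun h => by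
    simpa using congrArg (coeff 1) (congrArg constantCoeff h)
  obtain ⟨Q', rfl⟩ := X_dvd_iff.2 (hm.resolve_left h2)
  exact ⟨Q', mul_left_cancel₀ X_ne_zero (by linear_combination hQ)⟩

/-- Series in `u` (over series in `t`), restricted to the curve cut out by the kernel. -/
noncomputable def curveU : ℚ⟦X⟧⟦X⟧ →+* ℚ⟦X⟧⟦X⟧⟦X⟧ ⧸ Ideal.span {gesselKernel} :=
  (Ideal.Quotient.mk _).comp C

/-- Series in `v` (over series in `t`), restricted to the curve cut out by the kernel. -/
noncomputable def curveV : ℚ⟦X⟧⟦X⟧ →+* ℚ⟦X⟧⟦X⟧⟦X⟧ ⧸ Ideal.span {gesselKernel} :=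
  (Ideal.Quotient.mk _).comp (PowerSeries.map C)

lemma curveU_C (r : ℚ⟦X⟧) : curveU (C r) = curveV (C r) := by
  simp [curveU, curveV, map_C]

lemma curve_mk_eq_zero {F : ℚ⟦X⟧⟦X⟧⟦X⟧} :
    Ideal.Quotient.mk (Ideal.span {gesselKernel}) F = 0 ↔ gesselKernel ∣ F := by
  rw [Ideal.Quotient.eq_zero_iff_mem, Ideal.mem_span_singleton]

lemma curve_kernel : curveU X * curveV X =
    curveV (C X) * (1 + curveV X) * (1 + curveU X ^ 2 * curveV X) := by
  have : Ideal.Quotient.mk (Ideal.span {gesselKernel})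
      (C X * X - C (C X) * ((1 + X) * (1 + C X ^ 2 * X))) = 0 :=
    curve_mk_eq_zero.2 (dvd_of_eq rfl)
  rw [map_sub, sub_eq_zero] at this
  simp only [curveU, curveV, RingHom.comp_apply, map_X, map_C]
  simpa [mul_assoc] using this

lemma curve_invariant {I J : ℚ⟦X⟧⟦X⟧} (h : curveU I = curveV J) :
    I = C (constantCoeff J) ∧ J = C (constantCoeff J) := by
  refine invariant_eq_const (curve_mk_eq_zero.1 ?_)
  rw [map_sub, sub_eq_zero]
  exact h

lemma curve_cancel_U {x y : ℚ⟦X⟧⟦X⟧⟦X⟧ ⧸ Ideal.span {gesselKernel}}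
    (h : curveU X * x = curveU X * y) : x = y := by
  rw [← sub_eq_zero, ← mul_sub] at h
  rw [← sub_eq_zero]
  generalize x - y = z at *
  obtain ⟨F, rfl⟩ := Ideal.Quotient.mk_surjective z
  rw [curveU, RingHom.comp_apply, ← map_mul, curve_mk_eq_zero] at h
  exact curve_mk_eq_zero.2 (gesselKernel_dvd_of_dvd_C_X_mul h)

lemma curve_cancel_V {x y : ℚ⟦X⟧⟦X⟧⟦X⟧ ⧸ Ideal.span {gesselKernel}}
    (h : curveV X * x = curveV X * y) : x = y := by
  rw [← sub_eq_zero, ← mul_sub] at h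
  rw [← sub_eq_zero]
  generalize x - y = z at *
  obtain ⟨F, rfl⟩ := Ideal.Quotient.mk_surjective z
  rw [curveV, RingHom.comp_apply, map_X, ← map_mul, curve_mk_eq_zero] at h
  exact curve_mk_eq_zero.2 (gesselKernel_dvd_of_dvd_X_mul h)

/-- The Dirichlet invariant. -/
lemma dirichlet_invariant {P D w : ℚ⟦X⟧⟦X⟧} (hw : (1 + X) * w = 1)
    (hD : curveU X * curveV X = curveV (C X) * (curveU P + (1 + curveV X) * curveV D
      - curveV (C (constantCoeff P)))) :
    curveU X * curveV (X * w - C X ^ 2 * ((1 + X) * D - C (constantCoeff P))) =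
      curveV (C X) * curveU (1 + C X * X * P) := by
  have hw' := congrArg curveV hw
  have hK := curve_kernel
  simp only [map_mul, map_add, map_one, map_sub, map_pow, curveU_C] at *
  generalize curveU X = U at *
  generalize curveV X = V at *
  generalize curveV (C X) = T at *
  generalize curveV w = W at *
  linear_combination (T * U) * hD + W * hK + T * (1 + U ^ 2 * V) * hw'

/-- The Neumann invariant is a quadratic polynomial in the Dirichlet invariant. -/
lemma neumann_eq_quadratic {P D w : ℚ⟦X⟧⟦X⟧} (hw : (1 + X) * w = 1)
    (hD : curveU X * curveV X = curveV (C X) * (curveU P + (1 + curveV X) * curveV D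
      - curveV (C (constantCoeff P))))
    (hd : constantCoeff D = constantCoeff P)
    {H σ : ℚ⟦X⟧⟦X⟧}
    (hN : curveU (1 - C X * X * H) = (1 - curveU X ^ 2 * curveV X) * curveV σ) :
    X * (X - 4 * C X ^ 2 * (1 + X) ^ 2) * σ ^ 2 * w ^ 2 =
      (X * w - C X ^ 2 * ((1 + X) * D - C (constantCoeff P))) *
        (X * w - C X ^ 2 * ((1 + X) * D - C (constantCoeff P))
          - 2 * C X ^ 2 * C (constantCoeff H + constantCoeff P)) := by
  have hj := dirichlet_invariant hw hD
  have hw' := congrArg curveV hw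
  have hK := curve_kernel
  have hj0 : constantCoeff (X * w - C X ^ 2 * ((1 + X) * D - C (constantCoeff P))) = 0 := by
    simp [hd]
  set j := X * w - C X ^ 2 * ((1 + X) * D - C (constantCoeff P)) with hjdef
  obtain ⟨H', hH⟩ : ∃ H', H = X * H' + C (constantCoeff H) := ⟨_, eq_X_mul_shift_add_const H⟩
  obtain ⟨P', hP⟩ : ∃ P', P = X * P' + C (constantCoeff P) := ⟨_, eq_X_mul_shift_add_const P⟩
  set h₀ := constantCoeff H
  set p₀ := constantCoeff P
  have key : (1 - C X * X * H) ^ 2 - (1 + C X * X * P) ^ 2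
      + 2 * C X * C (h₀ + p₀) * X * (1 + C X * X * P) = X ^ 2 *
        (-2 * C X * H' - 2 * C X * P' + C X ^ 2 * H ^ 2 - C X ^ 2 * P ^ 2
          + 2 * C X * C (h₀ + p₀) * (C X * P)) := by
    rw [map_add]
    linear_combination (-2 * C X * X) * hH - 2 * C X * X * hP
  have inv := curve_invariant (I := C X ^ 2 * (-2 * C X * H' - 2 * C X * P' + C X ^ 2 * H ^ 2
      - C X ^ 2 * P ^ 2 + 2 * C X * C (h₀ + p₀) * (C X * P)))
    (J := X * (X - 4 * C X ^ 2 * (1 + X) ^ 2) * σ ^ 2 * w ^ 2 - j ^ 2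
      + 2 * C X ^ 2 * C (h₀ + p₀) * j) (by
    refine curve_cancel_U (curve_cancel_U ?_)
    have key' := congrArg curveU key
    simp only [map_mul (f := curveU) (C X ^ 2), map_mul (f := curveU) (X ^ 2), map_pow] at key' ⊢
    rw [show ∀ U T Z : ℚ⟦X⟧⟦X⟧⟦X⟧ ⧸ Ideal.span {gesselKernel},
      U * (U * (T ^ 2 * Z)) = T ^ 2 * (U ^ 2 * Z) by intros; ring, ← key']
    clear key'
    clear_value j
    simp only [map_mul, map_add, map_one, map_sub, map_pow, curveU_C, map_ofNat] at *
    generalize curveU X = U at *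
    generalize curveV X = V at *
    generalize curveV (C X) = T at *
    generalize curveV w = W at *
    generalize curveV j = J at *
    generalize curveV σ = S at *
    generalize curveU P = P at *
    generalize curveU H = H at *
    generalize curveV (C h₀) = h₀ at *
    generalize curveV (C p₀) = p₀ at *
    have e₁ : U * V * W = T * (1 + U ^ 2 * V) := by
      linear_combination W * hK + T * (1 + U ^ 2 * V) * hw'
    have e₂ : T ^ 2 * (1 - U ^ 2 * V) ^ 2 = U ^ 2 * V * (V - 4 * T ^ 2 * (1 + V) ^ 2) * W ^ 2 := by
      linear_combination (-U * V * W - T * (1 + U ^ 2 * V)) * e₁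
        + 4 * U ^ 2 * V * T ^ 2 * ((1 + V) * W + 1) * hw'
    rw [hN]
    linear_combination S ^ 2 * e₂ + (U * J + T * (1 + T * U * P)
      - 2 * U * T * (h₀ + p₀) * T) * hj)
  have hc := inv.2
  simp only [map_sub, map_add, map_mul, map_pow, hj0, constantCoeff_X] at hc
  simp only [zero_mul, mul_zero, sub_zero, ne_eq, OfNat.ofNat_ne_zero, not_false_eq_true,
    zero_pow, add_zero, map_zero] at hc
  simp only [map_add, p₀] at hc ⊢
  linear_combination hc

/-- The Dirichlet invariant satisfies a cubic equation over the rational invariant. -/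
lemma dirichlet_cubic {P D w : ℚ⟦X⟧⟦X⟧} (hw : (1 + X) * w = 1)
    (hD : curveU X * curveV X = curveV (C X) * (curveU P + (1 + curveV X) * curveV D
      - curveV (C (constantCoeff P))))
    (hd : constantCoeff D = constantCoeff P) : ∃ B γ : ℚ⟦X⟧,
    ((X ^ 2 + C X ^ 2 * (1 + X) ^ 4 - 4 * C X ^ 2 * X * (1 + X) ^ 2) * w ^ 2 *
        (X * w - C X ^ 2 * ((1 + X) * D - C (constantCoeff P))) +
      X * ((X * w - C X ^ 2 * ((1 + X) * D - C (constantCoeff P))) ^ 3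
        - C (1 + 2 * X * constantCoeff (C X * P)) *
          (X * w - C X ^ 2 * ((1 + X) * D - C (constantCoeff P))) ^ 2
        - C B * (X * w - C X ^ 2 * ((1 + X) * D - C (constantCoeff P))) - C γ) = 0) ∧
    C X ^ 2 * ((1 + X ^ 2) * (X - C X * (1 + X ^ 2)) * (1 + C X * X * P)
      + C X * (1 + C X * X * P) ^ 3
      - C (1 + 2 * X * constantCoeff (C X * P)) * X * (1 + C X * X * P) ^ 2)
      - C X * C B * X ^ 2 * (1 + C X * X * P) = X ^ 3 * C γ := by
  have hj := dirichlet_invariant hw hD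
  have hw' := congrArg curveV hw
  have hK := curve_kernel
  have hj0 : constantCoeff (X * w - C X ^ 2 * ((1 + X) * D - C (constantCoeff P))) = 0 := by
    simp [hd]
  set j := X * w - C X ^ 2 * ((1 + X) * D - C (constantCoeff P)) with hjdef
  obtain ⟨j', hj'⟩ := X_dvd_iff.2 hj0
  set e := C X * P with he
  have he' : C X * X * P = X * e := by rw [he]; ring
  rw [he'] at hj ⊢
  clear_value e j
  obtain ⟨f, hf⟩ : ∃ f, e = X * f + C (constantCoeff e) := ⟨_, eq_X_mul_shift_add_const e⟩
  obtain ⟨g, hg⟩ : ∃ g, f = X * g + C (constantCoeff f) := ⟨_, eq_X_mul_shift_add_const f⟩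
  set e₀ := constantCoeff e
  set e₁ := constantCoeff f
  set B' := 2 * X * e₁ + e₀ - 2 * X + 3 * X * e₀ ^ 2 - 2 * (1 + 2 * X * e₀) * e₀ with hB'
  obtain ⟨N, key⟩ : ∃ N, (1 + X ^ 2) * (X - C X * (1 + X ^ 2)) * (1 + X * e)
      + C X * (1 + X * e) ^ 3 - C (1 + 2 * X * e₀) * X * (1 + X * e) ^ 2
      - C B' * X ^ 2 * (1 + X * e) = X ^ 3 * N := by
    refine ⟨1 - C X * X - 2 * C X * e + X * e - C X * X ^ 2 * e + C X * e ^ 3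
      - C (1 + 2 * X * e₀) * e ^ 2 - C B' * e + 2 * C X * g + f + 6 * C X * C e₀ * f
      + 3 * C X * X * f ^ 2 - 2 * C (1 + 2 * X * e₀) * f, ?_⟩
    rw [hB']
    simp only [map_add, map_sub, map_mul, map_pow, map_one, map_ofNat]
    clear_value e₀ e₁
    subst hf
    rw [hg]
    ring
  have inv := curve_invariant (I := C X ^ 2 * N)
    (J := (X ^ 2 + C X ^ 2 * (1 + X) ^ 4 - 4 * C X ^ 2 * X * (1 + X) ^ 2) * w ^ 2 * j'
      + j ^ 3 - C (1 + 2 * X * e₀) * j ^ 2 - C X * C B' * j) (by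
    refine curve_cancel_V (curve_cancel_U (curve_cancel_U (curve_cancel_U ?_)))
    have key' := congrArg curveU key
    rw [map_mul curveU (X ^ 3), map_pow curveU] at key'
    rw [map_mul curveU (C X ^ 2), map_pow curveU]
    rw [show ∀ U T V Z : ℚ⟦X⟧⟦X⟧⟦X⟧ ⧸ Ideal.span {gesselKernel},
      U * (U * (U * (V * (T ^ 2 * Z)))) = T ^ 2 * V * (U ^ 3 * Z) by intros; ring, ← key']
    have hjV := congrArg curveV hj'
    clear key' key hf hg hjdef
    clear_value B' e₀ e₁
    generalize 1 + 2 * X * e₀ = A at *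
    simp only [map_mul, map_add, map_one, map_sub, map_pow, curveU_C, map_ofNat] at *
    generalize curveU X = U at *
    generalize curveV X = V at *
    generalize curveV (C X) = T at *
    generalize curveV w = W at *
    generalize curveV j = J at *
    generalize curveV j' = J' at *
    generalize curveU e = E at *
    generalize curveV (C A) = A at *
    generalize curveV (C B') = B' at *
    have e₀ : T * ((1 + U ^ 2) * (U - T * (1 + U ^ 2))) * V =
        U ^ 2 * (V ^ 2 + T ^ 2 * (1 + V) ^ 4 - 4 * T ^ 2 * V * (1 + V) ^ 2) * W ^ 2 := by
      have : T * ((1 + U ^ 2) * (U - T * (1 + U ^ 2))) * V * (1 + V) ^ 2 =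
        U ^ 2 * (V ^ 2 + T ^ 2 * (1 + V) ^ 4 - 4 * T ^ 2 * V * (1 + V) ^ 2) := by
        linear_combination (T * (1 + V) * (V + U ^ 2) - U * V) * hK
      linear_combination W ^ 2 * this
        - (T * ((1 + U ^ 2) * (U - T * (1 + U ^ 2))) * V) * ((1 + V) * W + 1) * hw'
    linear_combination T * (1 + U * E) * e₀
      + U ^ 3 * (V ^ 2 + T ^ 2 * (1 + V) ^ 4 - 4 * T ^ 2 * V * (1 + V) ^ 2) * W ^ 2 * hjV
      - (U ^ 2 * (V ^ 2 + T ^ 2 * (1 + V) ^ 4 - 4 * T ^ 2 * V * (1 + V) ^ 2) * W ^ 2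
        + V * ((U * J) ^ 2 + U * J * (T * (1 + U * E)) + (T * (1 + U * E)) ^ 2)
        - A * U * V * (U * J + T * (1 + U * E)) - B' * U ^ 2 * T * V) * hj)
  obtain ⟨inv₁, inv₂⟩ := inv
  generalize constantCoeff (_ + _ - _ - _ : ℚ⟦X⟧⟦X⟧) = γ at inv₁ inv₂
  refine ⟨X * B', γ, ?_, ?_⟩
  · rw [map_mul]
    linear_combination X * inv₂
      + (X ^ 2 + C X ^ 2 * (1 + X) ^ 4 - 4 * C X ^ 2 * X * (1 + X) ^ 2) * w ^ 2 * hj'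
  · rw [map_mul]
    linear_combination C X ^ 2 * key + X ^ 3 * inv₁

lemma exists_catalan_fixedPoint {k : Type*} [CommRing k] (s : k⟦X⟧) (hs : constantCoeff s = 0) :
    ∃ V : k⟦X⟧, constantCoeff V = 0 ∧ V = s * (1 + V) ^ 2 := by
  obtain ⟨φ, hX, -, -⟩ := exists_evalHom s hs
  have h := congrArg (fun F => φ (PowerSeries.map (Nat.castRingHom k⟦X⟧) F))
    catalanSeries_sq_mul_X_add_one
  simp only [map_add, map_mul, map_pow, map_one, map_X, hX] at h
  have hV : φ (PowerSeries.map (Nat.castRingHom k⟦X⟧) catalanSeries) - 1 =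
      s * (1 + (φ (PowerSeries.map (Nat.castRingHom k⟦X⟧) catalanSeries) - 1)) ^ 2 := by
    linear_combination -h
  exact ⟨_, by rw [hV, map_mul, hs, zero_mul], hV⟩

lemma ne_zero_of_fixedPoint {V s : ℚ⟦X⟧} (hs : s ≠ 0) (hV : V = s * (1 + V) ^ 2) : V ≠ 0 := by
  rintro rfl
  exact hs (by linear_combination -hV)

lemma exists_double_root_of_critical_point
    {w j Y : ℚ⟦X⟧⟦X⟧} {A B γ : ℚ⟦X⟧}
    (hw : (1 + X) * w = 1) (hj : j = X * w - C X ^ 2 * Y)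
    (hcubic : (X ^ 2 + C X ^ 2 * (1 + X) ^ 4 - 4 * C X ^ 2 * X * (1 + X) ^ 2) * w ^ 2 * j +
      X * (j ^ 3 - C A * j ^ 2 - C B * j - C γ) = 0)
    {s : ℚ⟦X⟧} (hs : s ^ 2 = X ^ 2) :
    ∃ z V Z, constantCoeff V = 0 ∧ z = s * (1 + V) - X ^ 2 * Z ∧
      z ^ 3 - A * z ^ 2 - B * z - γ + (2 * s - 4 * X ^ 2) * z = 0 ∧
      3 * z ^ 2 - 2 * A * z - B + (2 * s - 4 * X ^ 2) = 0 := by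
  have hs₀ : constantCoeff s = 0 := by
    simpa using congrArg constantCoeff hs
  have hs₁ : s ≠ 0 := by
    rintro rfl
    exact X_ne_zero (pow_eq_zero_iff two_ne_zero |>.1 (by linear_combination -hs))
  obtain ⟨V, hV₀, hV⟩ := exists_catalan_fixedPoint s hs₀
  have hV₁ := ne_zero_of_fixedPoint hs₁ hV
  obtain ⟨φ, hX, hC, hφ⟩ := exists_evalHom V hV₀
  have hwV := congrArg φ hw
  have hjV := congrArg φ hj
  have hcV := congrArg φ hcubic
  have hw' := congrArg (d⁄dX ℚ⟦X⟧) hw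
  have hj' := congrArg (d⁄dX ℚ⟦X⟧) hj
  have hdV := congrArg (fun F => φ (d⁄dX ℚ⟦X⟧ F)) hcubic
  have hw₀ : constantCoeff w = 1 := by simpa using congrArg constantCoeff hw
  have hw'V := congrArg φ hw'
  have hj'₀ : constantCoeff (φ (d⁄dX ℚ⟦X⟧ j)) = 1 := by
    rw [hφ, hj']
    simp [Derivation.leibniz, Derivation.leibniz_pow, hw₀]
  clear hj'
  have h4 : d⁄dX ℚ⟦X⟧ (4 : ℚ⟦X⟧⟦X⟧) = 0 := by
    rw [← map_ofNat C, derivative_C]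
  simp only [map_add, map_sub, map_mul, map_pow, Derivation.leibniz, Derivation.leibniz_pow,
    derivative_X, derivative_C, map_ofNat, map_one, smul_eq_mul, nsmul_eq_mul, hX, hC, map_zero,
    Derivation.map_one_eq_zero, h4, Nat.cast_ofNat] at hwV hjV hcV hdV hw'V
  generalize hz : φ j = z at *
  generalize hz' : φ (d⁄dX ℚ⟦X⟧ j) = z' at *
  generalize φ w = x at *
  generalize φ (d⁄dX ℚ⟦X⟧ w) = x' at *
  have hz'₀ : z' ≠ 0 := by rintro rfl; simp at hj'₀
  have hVx : V * x ^ 2 = s := by linear_combination x ^ 2 * hV + s * ((1 + V) * x + 1) * hwV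
  have hVx' : V * x = s * (1 + V) := by linear_combination (1 + V) * hVx - V * x * hwV
  have hx' : x' = -x ^ 2 := by linear_combination x * hw'V - x' * hwV
  have hM : (V ^ 2 + X ^ 2 * (1 + V) ^ 4 - 4 * X ^ 2 * V * (1 + V) ^ 2) * x ^ 2 =
      V * (2 * s - 4 * X ^ 2) := by
    linear_combination x ^ 2 * (-(V + s * (1 + V) ^ 2) * hV - (1 + V) ^ 4 * hs + 4 * V * s * hV
      + 4 * V * (1 + V) ^ 2 * hs) + V * (2 - 4 * s) * hVx - 4 * V * hs
  have hf : z ^ 3 - A * z ^ 2 - B * z - γ + (2 * s - 4 * X ^ 2) * z = 0 :=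
    mul_left_cancel₀ hV₁ (by linear_combination hcV - z * hM)
  have hM' : (V ^ 2 + X ^ 2 * (1 + V) ^ 4 - 4 * X ^ 2 * V * (1 + V) ^ 2) * (2 * x * x')
      + x ^ 2 * (2 * V + 4 * X ^ 2 * (1 + V) ^ 3 - 4 * X ^ 2 * (1 + V) ^ 2
        - 8 * X ^ 2 * V * (1 + V)) = 2 * s - 4 * X ^ 2 := by
    rw [hx']
    linear_combination -2 * x * hM + 2 * hVx - 4 * s * hVx' - 4 * (1 + V) * hs
      + (4 * X ^ 2 * (1 + V) * ((1 + V) * x + 1) - 4 * X ^ 2 * ((1 + V) * x + 1)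
        - 8 * X ^ 2 * V * x) * hwV
  refine ⟨z, V, φ Y, hV₀, ?_, hf, ?_⟩
  · rw [hjV, hVx']
  · refine mul_left_cancel₀ (mul_ne_zero hV₁ hz'₀) ?_
    linear_combination hdV - z' * hM - z * hM' - hf

/-- At the zero of the Neumann invariant, the Dirichlet invariant takes the value `S`, which is then
a root of the cubic at the critical level `1 / 4`. -/
lemma root_of_neumann_zero
    {w j Y : ℚ⟦X⟧⟦X⟧} {A B γ : ℚ⟦X⟧}
    (hw : (1 + X) * w = 1) (hj : j = X * w - C X ^ 2 * Y)
    (hcubic : (X ^ 2 + C X ^ 2 * (1 + X) ^ 4 - 4 * C X ^ 2 * X * (1 + X) ^ 2) * w ^ 2 * j +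
      X * (j ^ 3 - C A * j ^ 2 - C B * j - C γ) = 0)
    {S : ℚ⟦X⟧} {σ : ℚ⟦X⟧⟦X⟧} (hY : constantCoeff (constantCoeff Y) = 0)
    (hquad : X * (X - 4 * C X ^ 2 * (1 + X) ^ 2) * σ ^ 2 * w ^ 2 = j * (j - C S))
    {c : ℚ⟦X⟧} (hc : 4 * c = 1) :
    constantCoeff S = 0 ∧ S ^ 3 - A * S ^ 2 - B * S - γ + c * S = 0 := by
  have hs₁ : (4 * X ^ 2 : ℚ⟦X⟧) ≠ 0 :=
    mul_ne_zero (by norm_num) (pow_ne_zero 2 X_ne_zero)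
  obtain ⟨V, hV₀, hV⟩ := exists_catalan_fixedPoint (4 * X ^ 2 : ℚ⟦X⟧) (by simp)
  have hV₁ := ne_zero_of_fixedPoint hs₁ hV
  obtain ⟨φ, hX, hC, hφ⟩ := exists_evalHom V hV₀
  have hwV := congrArg φ hw
  have hjV := congrArg φ hj
  have hcV := congrArg φ hcubic
  have hqV := congrArg φ hquad
  have hY₀ : constantCoeff (φ Y) = 0 := by rw [hφ, hY]
  simp only [map_add, map_sub, map_mul, map_pow, map_ofNat, map_one, hX, hC, map_zero]
    at hwV hjV hcV hqV
  generalize φ j = z at *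
  generalize φ w = x at *
  generalize φ Y = y at *
  have hVx : V * x ^ 2 = 4 * X ^ 2 := by
    linear_combination x ^ 2 * hV + 4 * X ^ 2 * ((1 + V) * x + 1) * hwV
  have hVx' : V * x = 4 * X ^ 2 * (1 + V) := by
    linear_combination (1 + V) * hVx - V * x * hwV
  have hz : z = X ^ 2 * (4 * (1 + V) - y) := by linear_combination hjV + hVx'
  have hz₀ : z ≠ 0 := by
    rw [hz]
    refine mul_ne_zero (pow_ne_zero 2 X_ne_zero) fun h => ?_
    simpa [hV₀, hY₀, map_ofNat] using congrArg constantCoeff h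
  have hzS : z = S := sub_eq_zero.1 <| mul_left_cancel₀ hz₀ (by
    linear_combination -hqV + V * φ σ ^ 2 * x ^ 2 * hV)
  subst hzS
  refine ⟨by rw [hz]; simp, mul_left_cancel₀ hV₁ ?_⟩
  linear_combination hcV - z * (x ^ 2 * V * hV
    + X ^ 2 * (1 + V) ^ 2 * ((1 + V) * x + 1) * hwV - c * hV - X ^ 2 * (1 + V) ^ 2 * hc)

/-- The Dirichlet invariant on the `u`-side gives a double root of the cubic at the critical level
`1 / 4`. -/
lemma exists_double_root_of_critical_point_fst {P : ℚ⟦X⟧⟦X⟧} {A B γ : ℚ⟦X⟧}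
    (h : C X ^ 2 * ((1 + X ^ 2) * (X - C X * (1 + X ^ 2)) * (1 + C X * X * P)
      + C X * (1 + C X * X * P) ^ 3 - C A * X * (1 + C X * X * P) ^ 2)
      - C X * C B * X ^ 2 * (1 + C X * X * P) = X ^ 3 * C γ)
    {c : ℚ⟦X⟧} (hc : 4 * c = 1) :
    ∃ z, 2 * constantCoeff z = 1 ∧
      z ^ 3 - A * z ^ 2 - B * z - γ + c * z = 0 ∧ 3 * z ^ 2 - 2 * A * z - B + c = 0 := by
  have hs₁ : (4 * X ^ 2 : ℚ⟦X⟧) ≠ 0 :=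
    mul_ne_zero (by norm_num) (pow_ne_zero 2 X_ne_zero)
  obtain ⟨V, hV₀, hV⟩ := exists_catalan_fixedPoint (4 * X ^ 2 : ℚ⟦X⟧) (by simp)
  have hV₁ := ne_zero_of_fixedPoint hs₁ hV
  obtain ⟨U, hU⟩ : ∃ U : ℚ⟦X⟧, U = 2 * X * (1 + V) := ⟨_, rfl⟩
  have hUV : U ^ 2 = V := by rw [hU]; linear_combination -hV
  rw [← hUV] at hU
  have hU₀ : constantCoeff U = 0 := by rw [hU]; simp
  have hU₁ : U ≠ 0 := by rintro rfl; exact hV₁ (by rw [← hUV]; simp)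
  have hunit : constantCoeff (1 + U ^ 2) ≠ 0 := by simp [hU₀]
  obtain ⟨φ, hX, hC, hφ⟩ := exists_evalHom U hU₀
  have hd := congrArg (d⁄dX ℚ⟦X⟧) h
  generalize hi : 1 + C X * X * P = i at h hd
  have hi₀ : constantCoeff (φ i) = 1 := by rw [hφ, ← hi]; simp
  have hiV := congrArg φ h
  have hdV := congrArg φ hd
  simp only [map_add, map_sub, map_mul, map_pow, Derivation.leibniz, Derivation.leibniz_pow,
    derivative_X, derivative_C, map_ofNat, map_one, smul_eq_mul, nsmul_eq_mul, hX, hC, map_zero,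
    Derivation.map_one_eq_zero, Nat.cast_ofNat] at hiV hdV
  generalize φ i = x at *
  generalize φ (d⁄dX ℚ⟦X⟧ i) = x' at *
  have hc₀ : 4 * constantCoeff c = 1 := by
    simpa [map_ofNat] using congrArg constantCoeff hc
  obtain ⟨z, hz, hz₀⟩ : ∃ z, U * z = X * x ∧ 2 * constantCoeff z = 1 := by
    refine ⟨2 * c * (1 + U ^ 2)⁻¹ * x, ?_, ?_⟩
    · have := PowerSeries.mul_inv_cancel _ hunit
      generalize (1 + U ^ 2)⁻¹ = w at *
      linear_combination 2 * c * w * x * hU + 4 * c * X * x * this + X * x * hc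
    · simp [hi₀, hU₀, map_ofNat]
      linear_combination hc₀
  have hN : X * ((1 + U ^ 2) * (U - X * (1 + U ^ 2))) = c * U ^ 2 := by
    linear_combination -X * (1 + U ^ 2) * (U - X * (1 + U ^ 2)) * hc
      - c * (U - 2 * X * (1 + U ^ 2)) * hU
  have hN' : 2 * U * (U - X * (1 + U ^ 2)) + (1 + U ^ 2) * (1 - 2 * X * U) = 1 + U ^ 2 := by
    linear_combination 2 * U * hU
  have hU' : X * (1 + U ^ 2) = 2 * c * U := by
    linear_combination -2 * c * hU - X * (1 + U ^ 2) * hc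
  have hf : z ^ 3 - A * z ^ 2 - B * z - γ + c * z = 0 := by
    refine mul_left_cancel₀ (pow_ne_zero 3 hU₁) ?_
    linear_combination hiV - X * x * hN + (c * U ^ 2 + (X * x) ^ 2 + X * x * (U * z) + (U * z) ^ 2
      - A * U * (X * x + U * z) - B * U ^ 2) * hz
  refine ⟨z, hz₀, hf, ?_⟩
  have hne : X * x' - z ≠ 0 := fun h => by
    have := congrArg constantCoeff h
    simp at this
    simp [this] at hz₀
  refine mul_left_cancel₀ (mul_ne_zero (pow_ne_zero 2 hU₁) hne) ?_
  linear_combination hdV - 3 * U ^ 2 * hf - X * x' * hN - X ^ 2 * x * hN' - U * z * hU'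
    - (2 * A * U * X * x' + A * (X * x + U * z) + 2 * B * U - X * (1 + U ^ 2)
      - 3 * X * x' * (X * x + U * z)) * hz

/-- The functional equations of the Dirichlet and Neumann problems determine their solutions at the
origin. -/
theorem exists_system_of_functional_equations {P D H σ : ℚ⟦X⟧⟦X⟧}
    (hd : constantCoeff D = constantCoeff P)
    (hD : curveU X * curveV X = curveV (C X) * (curveU P + (1 + curveV X) * curveV D
      - curveV (C (constantCoeff P))))
    (hN : curveU (1 - C X * X * H) = (1 - curveU X ^ 2 * curveV X) * curveV σ) :
    ∃ x y : ℚ⟦X⟧, constantCoeff x = 1 ∧ constantCoeff y = 1 ∧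
      (x - y) * (x + y) ^ 3 = 3 * (16 * X ^ 2) ∧ x ^ 2 + 2 * x * y - 2 * y ^ 2 = 1 + 16 * X ^ 2 ∧
      x - y = 3 * X ^ 2 * (constantCoeff H + constantCoeff P) := by
  obtain ⟨w, hw⟩ : ∃ w : ℚ⟦X⟧⟦X⟧, (1 + X) * w = 1 :=
    (PowerSeries.isUnit_iff_constantCoeff.2 (by simp)).exists_right_inv
  obtain ⟨B, γ, hv, hu⟩ := dirichlet_cubic hw hD hd
  have hquad := neumann_eq_quadratic hw hD hd hN
  have hS : (2 * C X ^ 2 * C (constantCoeff H + constantCoeff P) : ℚ⟦X⟧⟦X⟧) =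
      C (2 * X ^ 2 * (constantCoeff H + constantCoeff P)) := by
    rw [map_mul, map_mul, map_pow, map_ofNat]
  rw [hS] at hquad
  obtain ⟨c, hc⟩ : ∃ c : ℚ⟦X⟧, 4 * c = 1 :=
    ⟨C (1 / 4), by rw [← map_ofNat C, ← map_mul]; norm_num⟩
  obtain ⟨z₁, V₁, Z₁, hV₁, hz₁, f₁, g₁⟩ :=
    exists_double_root_of_critical_point hw rfl hv (s := X) rfl
  obtain ⟨z₂, V₂, Z₂, hV₂, hz₂, f₂, g₂⟩ :=
    exists_double_root_of_critical_point hw rfl hv (s := -X) (neg_sq X)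
  obtain ⟨z₃, hz₃, f₃, g₃⟩ := exists_double_root_of_critical_point_fst hu hc
  obtain ⟨hr, fr⟩ := root_of_neumann_zero hw rfl hv (by simp [hd]) hquad hc
  have hne₃ {z : ℚ⟦X⟧} (h : constantCoeff z = 0) : z ≠ z₃ := by
    rintro rfl
    simp [h] at hz₃
  obtain ⟨y, hy₁, hy₂, hy₃, hy₄⟩ := system_of_double_roots rfl (by ring) hc f₁ g₁ f₂ g₂ f₃ g₃ fr
    (by
      intro h
      rw [hz₁, hz₂] at h
      have := mul_left_cancel₀ (X_ne_zero (R := ℚ)) (a := X) (b := 1 + V₁ - X * Z₁)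
        (c := -(1 + V₂) - X * Z₂) (by linear_combination h)
      have := congrArg constantCoeff this
      norm_num [hV₁, hV₂] at this)
    (hne₃ (by rw [hz₁]; simp)) (hne₃ (by rw [hz₂]; simp)) (hne₃ hr)
  have hx : constantCoeff (1 + 2 * X * constantCoeff (C X * P)) = (1 : ℚ) := by simp
  have hxy : 1 + 2 * X * constantCoeff (C X * P) - y =
      3 * X ^ 2 * (constantCoeff H + constantCoeff P) :=
    mul_left_cancel₀ (two_ne_zero (α := ℚ⟦X⟧)) (by linear_combination hy₁)
  refine ⟨_, y, hx, ?_, hy₃, hy₄, hxy⟩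
  have := congrArg constantCoeff hxy
  rw [map_sub, hx, sub_eq_iff_eq_add] at this
  simpa using this.symm

lemma walkCount_zero (steps region : Set (ℤ × ℤ)) (a b : ℤ × ℤ) [Decidable (a = b ∧ a ∈ region)] :
    walkCount steps region a b 0 = if a = b ∧ a ∈ region then 1 else 0 := by
  rw [walkCount]
  split_ifs with h
  · rw [Nat.card_eq_one_iff_unique]
    refine ⟨⟨fun w w' => Subtype.ext (funext fun k => ?_)⟩,
      ⟨⟨fun _ => a, rfl, h.1, fun k => k.elim0, fun _ => h.2⟩⟩⟩
    rw [Fin.fin_one_eq_zero k, w.2.1, w'.2.1]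
  · have : IsEmpty {w : Fin (0 + 1) → ℤ × ℤ // w 0 = a ∧ w (Fin.last 0) = b ∧
        (∀ k : Fin 0, w k.succ - w k.castSucc ∈ steps) ∧ ∀ k, w k ∈ region} :=
      ⟨fun w => h ⟨w.2.1.symm.trans w.2.2.1, w.2.1 ▸ w.2.2.2.2 0⟩⟩
    exact Nat.card_of_isEmpty

lemma walkCount_eq_zero_of_notMem {steps region : Set (ℤ × ℤ)} {a b : ℤ × ℤ} (hb : b ∉ region)
    (n : ℕ) : walkCount steps region a b n = 0 := by
  have : IsEmpty {w : Fin (n + 1) → ℤ × ℤ // w 0 = a ∧ w (Fin.last n) = b ∧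
      (∀ k : Fin n, w k.succ - w k.castSucc ∈ steps) ∧ ∀ k, w k ∈ region} :=
    ⟨fun w => hb (w.2.2.1 ▸ w.2.2.2.2 (Fin.last n))⟩
  exact Nat.card_of_isEmpty

section Recursion

variable (steps region : Set (ℤ × ℤ)) (a b : ℤ × ℤ)

/-- Walks from `a` to `b` confined to `region`; they are counted by `walkCount`. -/
abbrev ConfinedWalk (n : ℕ) : Type :=
  {w : Fin (n + 1) → ℤ × ℤ // w 0 = a ∧ w (Fin.last n) = b ∧
    (∀ k : Fin n, w k.succ - w k.castSucc ∈ steps) ∧ ∀ k, w k ∈ region}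

variable {steps region a b}

/-- Appending the last step to a walk. -/
def ConfinedWalk.append (hb : b ∈ region) {n : ℕ}
    (p : Σ s : steps, ConfinedWalk steps region a (b - s) n) :
    ConfinedWalk steps region a b (n + 1) := by
  refine ⟨Fin.snoc (α := fun _ => ℤ × ℤ) p.2.1 b, ?_, Fin.snoc_last _ _, fun k => ?_, fun k => ?_⟩
  · exact (Fin.snoc_castSucc (α := fun _ => ℤ × ℤ) b p.2.1 0).trans p.2.2.1
  · induction k using Fin.lastCases with
    | last =>
      rw [Fin.succ_last, Fin.snoc_last, Fin.snoc_castSucc, p.2.2.2.1, sub_sub_cancel]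
      exact p.1.2
    | cast k =>
      rw [Fin.succ_castSucc, Fin.snoc_castSucc, Fin.snoc_castSucc]
      exact p.2.2.2.2.1 k
  · induction k using Fin.lastCases with
    | last => rwa [Fin.snoc_last]
    | cast k => rw [Fin.snoc_castSucc]; exact p.2.2.2.2.2 k

lemma ConfinedWalk.append_bijective (hb : b ∈ region) (n : ℕ) :
    Function.Bijective (ConfinedWalk.append (steps := steps) (a := a) hb (n := n)) := by
  constructor
  · rintro ⟨s, w⟩ ⟨s', w'⟩ h
    have hw : w.1 = w'.1 := (Fin.snoc_injective2 (α := fun _ => ℤ × ℤ) (Subtype.ext_iff.1 h)).1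
    have hs : s = s' := Subtype.ext <| sub_right_injective <| by
      have := congrFun hw (Fin.last n)
      rwa [w.2.2.1, w'.2.2.1] at this
    subst hs
    rw [Subtype.ext hw]
  · rintro ⟨w, h₀, hl, hs, hr⟩
    refine ⟨⟨⟨b - w (Fin.last n).castSucc, ?_⟩, ⟨Fin.init w, h₀, ?_, fun k => ?_, fun k => hr _⟩⟩,
      ?_⟩
    · rw [← hl]; exact hs (Fin.last n)
    · exact (sub_sub_cancel _ _).symm
    · exact hs k.castSucc
    · refine Subtype.ext ?_
      change Fin.snoc (Fin.init w) b = w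
      rw [← hl, Fin.snoc_init_self]

lemma ConfinedWalk.finite (hs : steps.Finite) (n : ℕ) (b : ℤ × ℤ) :
    Finite (ConfinedWalk steps region a b n) := by
  have := hs.to_subtype
  induction n generalizing b with
  | zero =>
    have : Subsingleton (ConfinedWalk steps region a b 0) := ⟨fun w w' =>
      Subtype.ext (funext fun k => by rw [Fin.fin_one_eq_zero k, w.2.1, w'.2.1])⟩
    infer_instance
  | succ n ih =>
    by_cases hb : b ∈ region
    · exact Finite.of_surjective _ (ConfinedWalk.append_bijective hb n).2
    · have : IsEmpty (ConfinedWalk steps region a b (n + 1)) :=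
        ⟨fun w => hb (w.2.2.1 ▸ w.2.2.2.2 (Fin.last _))⟩
      infer_instance

lemma walkCount_succ {S : Finset (ℤ × ℤ)} (hb : b ∈ region) (n : ℕ) :
    walkCount S region a b (n + 1) = ∑ s ∈ S, walkCount S region a (b - s) n := by
  have (s : (S : Set (ℤ × ℤ))) := ConfinedWalk.finite (a := a) (region := region)
    S.finite_toSet n (b - s)
  rw [walkCount, ← Nat.card_congr (Equiv.ofBijective _ (ConfinedWalk.append_bijective hb n)),
    Nat.card_sigma]
  exact Finset.sum_coe_sort S fun s => walkCount S region a (b - s) n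

end Recursion

/-- The number of square-lattice walks in the three-quadrant cone from `(-1, 0)` to `(i, j)`. -/
noncomputable def coneCount (n : ℕ) (i j : ℤ) : ℚ := walkCount squareSteps coneC (-1, 0) (i, j) n

lemma coneCount_zero (i j : ℤ) : coneCount 0 i j = if i = -1 ∧ j = 0 then 1 else 0 := by
  classical
  rw [coneCount, walkCount_zero]
  simp [coneC, eq_comm]

lemma coneCount_eq_zero {i j : ℤ} (hi : i < 0) (hj : j < 0) (n : ℕ) : coneCount n i j = 0 := by
  rw [coneCount, walkCount_eq_zero_of_notMem, Nat.cast_zero]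
  simp [coneC, hi, hj]

lemma coneCount_succ {i j : ℤ} (h : 0 ≤ i ∨ 0 ≤ j) (n : ℕ) :
    coneCount (n + 1) i j = coneCount n (i - 1) j + coneCount n (i + 1) j
      + coneCount n i (j - 1) + coneCount n i (j + 1) := by
  have hS : squareSteps = (({(1,0), (-1,0), (0,1), (0,-1)} : Finset (ℤ × ℤ)) : Set (ℤ × ℤ)) := by
    simp [squareSteps]
  simp only [coneCount, hS]
  rw [walkCount_succ (show (i, j) ∈ coneC from h)]
  simp [add_assoc]

/-- The part of the walk count that is odd under the reflection in the diagonal, at the point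
`(v - u, v)`. -/
noncomputable def oddCount (n : ℕ) (u v : ℤ) : ℚ := coneCount n (v - u) v - coneCount n v (v - u)

/-- The part of the walk count that is even under the reflection in the diagonal, at the point
`(v - u, v)`. -/
noncomputable def evenCount (n : ℕ) (u v : ℤ) : ℚ := coneCount n (v - u) v + coneCount n v (v - u)

lemma oddCount_zero {u : ℤ} (hu : 0 ≤ u) (v : ℤ) :
    oddCount 0 u v = if u = 1 ∧ v = 0 then 1 else 0 := by
  rw [oddCount, coneCount_zero, coneCount_zero, if_neg (c := v = -1 ∧ _) (by lia), sub_zero]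
  congr 1
  simp only [eq_iff_iff]
  lia

lemma evenCount_zero {u : ℤ} (hu : 0 ≤ u) (v : ℤ) :
    evenCount 0 u v = if u = 1 ∧ v = 0 then 1 else 0 := by
  rw [evenCount, coneCount_zero, coneCount_zero, if_neg (c := v = -1 ∧ _) (by lia), add_zero]
  congr 1
  simp only [eq_iff_iff]
  lia

lemma oddCount_zero_left (n : ℕ) (v : ℤ) : oddCount n 0 v = 0 := by
  simp [oddCount]

lemma oddCount_of_neg {u v : ℤ} (hu : 0 ≤ u) (hv : v < 0) (n : ℕ) : oddCount n u v = 0 := by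
  rw [oddCount, coneCount_eq_zero (by lia) hv, coneCount_eq_zero hv (by lia), sub_zero]

lemma evenCount_of_neg {u v : ℤ} (hu : 0 ≤ u) (hv : v < 0) (n : ℕ) : evenCount n u v = 0 := by
  rw [evenCount, coneCount_eq_zero (by lia) hv, coneCount_eq_zero hv (by lia), add_zero]

lemma oddCount_succ {v : ℤ} (hv : 0 ≤ v) (n : ℕ) (u : ℤ) :
    oddCount (n + 1) u v = oddCount n (u + 1) (v + 1) + oddCount n (u + 1) v
      + oddCount n (u - 1) v + oddCount n (u - 1) (v - 1) := by
  simp only [oddCount]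
  rw [coneCount_succ (.inr hv), coneCount_succ (.inl hv)]
  ring_nf

lemma evenCount_succ {v : ℤ} (hv : 0 ≤ v) (n : ℕ) (u : ℤ) :
    evenCount (n + 1) u v = evenCount n (u + 1) (v + 1) + evenCount n (u + 1) v
      + evenCount n (u - 1) v + evenCount n (u - 1) (v - 1) := by
  simp only [evenCount]
  rw [coneCount_succ (.inr hv), coneCount_succ (.inl hv)]
  ring_nf

lemma evenCount_neg (n : ℕ) (u v : ℤ) : evenCount n (-u) v = evenCount n u (v + u) := by
  simp only [evenCount]
  ring_nf

lemma evenCount_succ_zero {v : ℤ} (hv : 0 ≤ v) (n : ℕ) :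
    evenCount (n + 1) 0 v = 2 * (evenCount n 1 (v + 1) + evenCount n 1 v) := by
  have h₁ := evenCount_neg n 1 v
  have h₂ := evenCount_neg n 1 (v - 1)
  rw [evenCount_succ hv, zero_sub, zero_add, h₁, h₂, sub_add_cancel]
  ring

lemma gesselKernel_mul_eq {Q E : ℚ⟦X⟧⟦X⟧⟦X⟧}
    (h₀ : constantCoeff E = -(C X * constantCoeff Q))
    (h₁ : PowerSeries.map constantCoeff E = -(C X * ((1 + X) * PowerSeries.map constantCoeff Q)))
    (h : ∀ k l, coeff (k + 1) (coeff (l + 1) (gesselKernel * Q)) =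
      coeff (k + 1) (coeff (l + 1) E)) :
    gesselKernel * Q = E := by
  ext1 l
  rcases l with _ | l
  · rw [coeff_zero_eq_constantCoeff_apply, coeff_zero_eq_constantCoeff_apply, h₀]
    simp [gesselKernel]
  · ext1 k
    rcases k with _ | k
    · rw [coeff_zero_eq_constantCoeff_apply, coeff_zero_eq_constantCoeff_apply, ← coeff_map,
        ← coeff_map, h₁]
      simp only [gesselKernel, map_mul, map_sub, map_add, map_one, map_pow, map_C, map_X,
        constantCoeff_X, constantCoeff_C]
      congr 1
      rw [map_zero]
      ring
    · exact h k l

lemma constantCoeff_map {R S : Type*} [CommRing R] [CommRing S] (f : R →+* S) (F : R⟦X⟧) :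
    constantCoeff (PowerSeries.map f F) = f (constantCoeff F) := by
  rw [← coeff_zero_eq_constantCoeff_apply, coeff_map, coeff_zero_eq_constantCoeff_apply]

lemma map_constantCoeff_map_C {R : Type*} [CommRing R] (F : R⟦X⟧) :
    PowerSeries.map constantCoeff (PowerSeries.map C F) = F := by
  ext
  simp

lemma dirichlet_functional_equation :
    gesselKernel * (mk fun l => mk fun k => mk fun n => oddCount n (k + 1) l) =
      C X * X - C (C X) * (C (mk fun k => mk fun n => oddCount n (k + 1) 0)
        + (1 + X) * PowerSeries.map C (mk fun l => mk fun n => oddCount n 1 l)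
        - C (C (mk fun n => oddCount n 1 0))) := by
  refine gesselKernel_mul_eq ?_ ?_ fun k l => ?_
  · simp [constantCoeff_map]
  · simp only [map_sub, map_mul, map_add, map_one, map_C, map_X, constantCoeff_C, constantCoeff_X,
      map_constantCoeff_map_C]
    have : PowerSeries.map constantCoeff (mk fun l : ℕ => mk fun k : ℕ => mk fun n =>
        oddCount n (k + 1) l) = mk fun l : ℕ => mk fun n => oddCount n 1 l := by
      ext; simp
    simp [this]
  · have hE : coeff (k + 1) (coeff (l + 1) (C X * X - C (C X) *
        (C (mk fun k => mk fun n => oddCount n (k + 1) 0)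
          + (1 + X) * PowerSeries.map C (mk fun l => mk fun n => oddCount n 1 l)
          - C (C (mk fun n => oddCount n 1 0))))) = if k = 0 ∧ l = 0 then (1 : ℚ⟦X⟧) else 0 := by
      rcases k with _ | k <;> rcases l with _ | l <;>
        simp [coeff_succ_X_mul, coeff_C, coeff_X, add_mul]
    rw [coeff_gesselKernel_mul, hE]
    have h₀ : oddCount 0 (k + 1) l = if k = 0 ∧ l = 0 then 1 else 0 := by
      rw [oddCount_zero (by positivity)]
      simp
    ext n
    rw [map_sub]
    rcases n with _ | n
    · simp [h₀, apply_ite (coeff 0)]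
    · rw [coeff_succ_X_mul]
      have h := oddCount_succ (Int.natCast_nonneg l) n (k + 1)
      simp only [map_add, coeff_mk, apply_ite (coeff n), map_zero, h]
      rcases k with _ | k <;> rcases l with _ | l <;>
        simp [oddCount_zero_left, coeff_one]
      exact oddCount_of_neg (by positivity) (by norm_num) n

lemma neumann_functional_equation :
    gesselKernel * (mk fun l => mk fun k => mk fun n =>
        if k = 0 then evenCount n 0 l / 2 else evenCount n k l) =
      C (X ^ 2) * X - C (C X) * (C (X * mk fun k => mk fun n => evenCount n (k + 1) 0)
        + ((1 + X) * PowerSeries.map C (mk fun l => mk fun n => evenCount n 0 l / 2)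
          - C (X ^ 2) * (X * ((1 + X) *
            PowerSeries.map C (mk fun l => mk fun n => evenCount n 0 l / 2))))) := by
  refine gesselKernel_mul_eq ?_ ?_ fun k l => ?_
  · have : (mk fun k : ℕ => mk fun n => if k = 0 then evenCount n 0 0 / 2 else evenCount n k 0) =
        X * (mk fun k : ℕ => mk fun n => evenCount n (k + 1) 0)
          + C (mk fun n => evenCount n 0 0 / 2) := by
      ext k n
      rcases k with _ | k <;> simp [coeff_succ_X_mul]
    simp [constantCoeff_map, this]
  · have : PowerSeries.map constantCoeff (mk fun l : ℕ => mk fun k : ℕ => mk fun n =>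
        if k = 0 then evenCount n 0 l / 2 else evenCount n k l) =
        mk fun l : ℕ => mk fun n => evenCount n 0 l / 2 := by
      ext; simp
    simp [map_constantCoeff_map_C, this]
  · have hE : coeff (k + 1) (coeff (l + 1) (C (X ^ 2) * X
        - C (C X) * (C (X * mk fun k => mk fun n => evenCount n (k + 1) 0)
        + ((1 + X) * PowerSeries.map C (mk fun l => mk fun n => evenCount n 0 l / 2)
          - C (X ^ 2) * (X * ((1 + X) *
            PowerSeries.map C (mk fun l => mk fun n => evenCount n 0 l / 2))))))) =
        (if k = 1 ∧ l = 0 then (1 : ℚ⟦X⟧) else 0) + if k = 1 then X * ((mk fun n =>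
          evenCount n 0 l / 2) + if 1 ≤ l then mk fun n => evenCount n 0 (l - 1) / 2 else 0)
        else 0 := by
      rcases k with _ | _ | k <;> rcases l with _ | l <;>
        simp [coeff_succ_X_mul, coeff_C, add_mul, coeff_X_pow_mul', coeff_X_pow,
          constantCoeff_map, -map_pow]
      ring
    rw [coeff_gesselKernel_mul, hE]
    have h₀ : evenCount 0 k l = if k = 1 ∧ l = 0 then 1 else 0 := by
      rw [evenCount_zero (by positivity)]
      simp
    ext n
    rw [map_sub, map_add]
    rcases n with _ | n
    · rcases k with _ | _ | k
      · simp [evenCount_zero]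
      · simp [evenCount_zero, apply_ite (coeff 0)]
      · push_cast at h₀
        simp [h₀]
    · rw [coeff_succ_X_mul]
      have h := evenCount_succ (Int.natCast_nonneg l) n k
      have h' := evenCount_succ_zero (Int.natCast_nonneg l) n
      simp only [map_add, coeff_mk, apply_ite (coeff n), map_zero, h, h']
      rcases k with _ | _ | k <;> rcases l with _ | l <;>
        simp [coeff_one, coeff_succ_X_mul, evenCount_of_neg le_rfl neg_one_lt_zero]
      · ring
      · ring
      · exact evenCount_of_neg (by positivity) (by norm_num) n

lemma exists_system_of_coneCount :
    ∃ x y : ℚ⟦X⟧, constantCoeff x = 1 ∧ constantCoeff y = 1 ∧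
      (x - y) * (x + y) ^ 3 = 3 * (16 * X ^ 2) ∧ x ^ 2 + 2 * x * y - 2 * y ^ 2 = 1 + 16 * X ^ 2 ∧
      x - y = X ^ 2 * mk fun n => 6 * coneCount n (-1) 0 := by
  have hD := curve_mk_eq_zero.2 ⟨_, dirichlet_functional_equation.symm⟩
  have hN := curve_mk_eq_zero.2 ⟨_, neumann_functional_equation.symm⟩
  obtain ⟨x, y, hx, hy, h₁, h₂, h₃⟩ := exists_system_of_functional_equations
    (P := mk fun k => mk fun n => oddCount n (k + 1) 0)
    (D := mk fun l => mk fun n => oddCount n 1 l)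
    (H := mk fun k => mk fun n => evenCount n (k + 1) 0)
    (σ := 1 + C X * (1 + X) * mk fun l => mk fun n => evenCount n 0 l / 2)
    (by simp)
    (by
      have hP : constantCoeff (mk fun k : ℕ => mk fun n => oddCount n (k + 1) 0) =
          mk fun n => oddCount n 1 0 := by simp
      rw [hP]
      simp only [curveU, curveV, RingHom.comp_apply, map_X, map_C]
      simp only [map_sub, map_mul, map_add, map_one] at hD ⊢
      linear_combination hD)
    (by
      simp only [curveU, curveV, RingHom.comp_apply, map_X, map_C, map_sub, map_mul, map_add,
        map_one, map_pow] at hN ⊢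
      linear_combination hN)
  refine ⟨x, y, hx, hy, h₁, h₂, h₃.trans ?_⟩
  rw [mul_comm 3, mul_assoc]
  congr 1
  ext n
  rw [← map_ofNat C 3, coeff_C_mul, coeff_mk]
  simp [oddCount, evenCount]
  ring

end LoopCount

theorem square_threeQuadrant_minusOne_loop_count (n : ℕ) :
    (walkCount squareSteps coneC (-1, 0) (-1, 0) (2*n) : ℚ) =
      16^n / 3 *
        (2 * (poch (1/2) n * poch (7/6) n) / (poch 2 n * poch (4/3) n)
          + (poch (1/2) n * poch (5/6) n) / (poch 2 n * poch (5/3) n)) := by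
  obtain ⟨x, y, hx, hy, h₁, h₂, h₃⟩ := exists_system_of_coneCount
  have h := congrArg (PowerSeries.coeff (2 * n + 2)) h₃
  rw [map_sub, PowerSeries.coeff_X_pow_mul, PowerSeries.coeff_mk, coeff_fst_of_system hx hy h₁ h₂,
    coeff_snd_of_system hx hy h₁ h₂] at h
  change coneCount (2 * n) (-1) 0 = _
  linear_combination -h / 6
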